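/- Let G be a connected, locally finite digraph in which every vertex has out-degree at least its in-degree, and suppose at least one vertex has out-degree strictly greater than its in-degree. Then G is transient: the random walk on G visits each vertex at most finitely often almost surely. -/

import Mathlib

open MeasureTheory Filter Set
open scoped ENNReal

namespace DF

/-! ### Sequences over a countable state space -/

variable {S : Type}

/-- The number of transitions from `u` to `v` among the first `n` steps of the sequence `x`. -/
noncomputable def transCount (x : ℕ → S) (n : ℕ) (u v : S) : ℕ :=
  Set.ncard {i : ℕ | i < n ∧ x i = u ∧ x (i + 1) = v}

/-- The equivalence `(x₀,…,xₙ) ≃ (y₀,…,yₙ)` of finite sequences: same initial state and the same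
transition counts between every ordered pair of states. -/
def FinEquiv (x y : ℕ → S) (n : ℕ) : Prop :=
  x 0 = y 0 ∧ ∀ u v : S, transCount x n u v = transCount y n u v

/-- The equivalence `x ≃ y` of infinite sequences: they eventually agree and their initial
segments up to that point are `≃`-equivalent. -/
def InfEquiv (x y : ℕ → S) : Prop :=
  ∃ N : ℕ, (∀ n : ℕ, N ≤ n → x n = y n) ∧ FinEquiv x y N

/-- The transition numbers `M(u,v) = #{i ≥ 0 : (xᵢ, xᵢ₊₁) = (u,v)}` of an infinite sequence. -/
noncomputable def transNum (x : ℕ → S) (u v : S) : ℕ∞ :=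
  Set.encard {i : ℕ | x i = u ∧ x (i + 1) = v}

/-- The sigma-algebra on `S^ℕ` generated by the transition numbers. -/
noncomputable def transSigma (S : Type) : MeasurableSpace (ℕ → S) :=
  ⨆ u : S, ⨆ v : S, MeasurableSpace.comap (fun x => transNum x u v) (⊤ : MeasurableSpace ℕ∞)

/-- The tail sigma-algebra `⋂ₙ σ(Xₙ, Xₙ₊₁, …)` on `S^ℕ`. -/
def tailSigma (S : Type) [MeasurableSpace S] : MeasurableSpace (ℕ → S) :=
  ⨅ n : ℕ, MeasurableSpace.comap (fun (x : ℕ → S) (i : ℕ) => x (i + n))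
    (inferInstance : MeasurableSpace (ℕ → S))

/-- A measure on `S^ℕ` is partially exchangeable if any two `≃`-equivalent finite initial
segments have the same probability. -/
def PartiallyExchangeable [MeasurableSpace S] (μ : Measure (ℕ → S)) : Prop :=
  ∀ (n : ℕ) (x y : ℕ → S), FinEquiv x y n →
    μ {ω | ∀ i ≤ n, ω i = x i} = μ {ω | ∀ i ≤ n, ω i = y i}

/-- The set of partially exchangeable probability measures on `S^ℕ`. -/
def PEProb (S : Type) [MeasurableSpace S] : Set (Measure (ℕ → S)) :=
  {μ | μ Set.univ = 1 ∧ PartiallyExchangeable μ}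

/-- `μ` is an extreme point of the convex set of partially exchangeable probability measures. -/
def IsExtremePE [MeasurableSpace S] (μ : Measure (ℕ → S)) : Prop :=
  μ ∈ PEProb S ∧
    ∀ μ₁ ∈ PEProb S, ∀ μ₂ ∈ PEProb S, ∀ t : ℝ≥0∞, 0 < t → t < 1 →
      μ = t • μ₁ + (1 - t) • μ₂ → μ₁ = μ₂

/-! ### Digraphs -/

/-- A digraph on vertex set `V` with edge set `E`: each edge has a tail (`src`) and head (`dst`).
Multiple edges and loops are allowed. -/
structure DigraphStruct (V E : Type) where
  src : E → V
  dst : E → V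

namespace DigraphStruct

variable {V E : Type} (G : DigraphStruct V E)

def outEdges (v : V) : Set E := {e | G.src e = v}

def inEdges (v : V) : Set E := {e | G.dst e = v}

noncomputable def outDeg (v : V) : ℕ := (G.outEdges v).ncard

noncomputable def inDeg (v : V) : ℕ := (G.inEdges v).ncard

def LocallyFinite : Prop := ∀ v : V, (G.outEdges v).Finite ∧ (G.inEdges v).Finite

/-- Adjacency in the underlying undirected graph. -/
def undirAdj (u v : V) : Prop :=
  ∃ e : E, (G.src e = u ∧ G.dst e = v) ∨ (G.src e = v ∧ G.dst e = u)

/-- `G` is connected as an undirected graph. -/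
def Connected : Prop := ∀ u v : V, Relation.ReflTransGen G.undirAdj u v

def dirAdj (u v : V) : Prop := ∃ e : E, G.src e = u ∧ G.dst e = v

/-- One step along an edge of the edge set `B`. -/
def step (B : Set E) (u v : V) : Prop := ∃ e ∈ B, G.src e = u ∧ G.dst e = v

/-- `(G,o)` is an infinite sourced Eulerian digraph (with sink at infinity). -/
structure IsSourcedEulerian (o : V) : Prop where
  infinite : Infinite V
  locFin : G.LocallyFinite
  conn : G.Connected
  balanced : ∀ v : V, v ≠ o → G.inDeg v = G.outDeg v
  source : G.outDeg o = G.inDeg o + 1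

/-- The reversal of `G`: head and tail of every edge are exchanged. -/
def rev : DigraphStruct V E := ⟨G.dst, G.src⟩

/-- One-step transition probability of the random walk on `G`. -/
noncomputable def stepProb (u v : V) : ℝ≥0∞ :=
  ({e : E | G.src e = u ∧ G.dst e = v}.ncard : ℝ≥0∞) / (G.outDeg u : ℝ≥0∞)

open Classical in
/-- `μ` is the law of the random walk on `G` started at `o`, characterised through its cylinder
probabilities. -/
def IsWalkLaw [MeasurableSpace V] (o : V) (μ : Measure (ℕ → V)) : Prop :=
  μ Set.univ = 1 ∧
    ∀ (n : ℕ) (x : ℕ → V),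
      μ {ω | ∀ i ≤ n, ω i = x i} =
        if x 0 = o then ∏ i ∈ Finset.range n, G.stepProb (x i) (x (i + 1)) else 0

/-- `G` is transient: from every starting point, the random walk on `G` visits every vertex at
most finitely often almost surely. -/
def TransientDigraph [MeasurableSpace V] : Prop :=
  ∀ (o : V) (μ : Measure (ℕ → V)),
    G.IsWalkLaw o μ → μ {ω | ∀ v : V, {i : ℕ | ω i = v}.Finite} = 1

/-- An infinite path in `G` indexed by `ℕ`, encoded by its sequence of edges. -/
def IsInfPath (γ : ℕ → E) : Prop := ∀ i : ℕ, G.dst (γ i) = G.src (γ (i + 1))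

/-- A transient path: it visits every vertex at most finitely often. -/
def IsTransientPath (γ : ℕ → E) : Prop := ∀ v : V, {i : ℕ | G.src (γ i) = v}.Finite

/-- The edge set of the last-exit arboretum `𝓛(γ)`: the edges crossed by `γ` as it exits their
tail for the last time. -/
def lastExitSet (γ : ℕ → E) : Set E :=
  {e | ∃ i : ℕ, γ i = e ∧ ∀ j : ℕ, i < j → G.src (γ j) ≠ G.src (γ i)}

end DigraphStruct

/-! ### Finite paths, Eulerian paths, arborescences -/

/-- `IsPathList G o z P` means that the list of edges `P` forms a directed path from `o`
to `z` in `G`. -/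
def IsPathList {V E : Type} (G : DigraphStruct V E) : V → V → List E → Prop
  | o, z, [] => o = z
  | o, z, e :: es => G.src e = o ∧ IsPathList G (G.dst e) z es

/-- `P` is an Eulerian path from `o` to `z`: a path crossing every edge exactly once. -/
def IsEulerList {V E : Type} (G : DigraphStruct V E) (o z : V) (P : List E) : Prop :=
  IsPathList G o z P ∧ P.Nodup ∧ ∀ e : E, e ∈ P

/-- `B` is (the edge set of) a spanning in-arborescence of `G` rooted at `z`. -/
def IsFinArb {V E : Type} (G : DigraphStruct V E) (z : V) (B : Set E) : Prop :=
  (∀ e ∈ B, G.src e ≠ z) ∧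
  (∀ v : V, v ≠ z → ∃! e : E, e ∈ B ∧ G.src e = v) ∧
  (∀ v : V, Relation.ReflTransGen (G.step B) v z)

/-- `(G,o,z)` is a finite Eulerian digraph with source `o` and sink `z`. -/
structure IsFinEulerian {V E : Type} (G : DigraphStruct V E) (o z : V) : Prop where
  finV : Finite V
  finE : Finite E
  reach_from : ∀ v : V, Relation.ReflTransGen G.dirAdj o v
  reach_to : ∀ v : V, Relation.ReflTransGen G.dirAdj v z
  bal_ne : o ≠ z → (∀ v : V, v ≠ o → v ≠ z → G.inDeg v = G.outDeg v) ∧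
      G.outDeg o = G.inDeg o + 1 ∧ G.inDeg z = G.outDeg z + 1
  bal_eq : o = z → ∀ v : V, G.inDeg v = G.outDeg v

/-! ### Wired uniform spanning in-arborescences -/

/-- An exhaustion of the vertex set by finite subsets. -/
def IsExhaustion {V : Type} (Vn : ℕ → Set V) : Prop :=
  (∀ n, (Vn n).Finite) ∧ (∀ n, Vn n ⊆ Vn (n + 1)) ∧ (⋃ n, Vn n) = Set.univ

/-- `B` is (the edge set of) a spanning in-arborescence of the wired graph `G_U^*`
(all vertices outside `U` identified to a single boundary vertex) rooted at the boundary. -/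
def IsWiredArb {V E : Type} (G : DigraphStruct V E) (U : Set V) (B : Set E) : Prop :=
  (∀ e ∈ B, G.src e ∈ U) ∧ (∀ v ∈ U, ∃! e : E, e ∈ B ∧ G.src e = v) ∧
  (∀ v ∈ U, ∃ v' : V, v' ∉ U ∧ Relation.ReflTransGen (G.step B) v v')

/-- The probability, under the uniform spanning in-arborescence of the wired graph `G_U^*`
rooted at the boundary, that all edges of `F` are present. -/
noncomputable def wiredUACyl {V E : Type} (G : DigraphStruct V E) (U : Set V) (F : Finset E) :
    ℝ≥0∞ :=
  (Nat.card {B : Set E // IsWiredArb G U B ∧ (F : Set E) ⊆ B} : ℝ≥0∞) /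
    (Nat.card {B : Set E // IsWiredArb G U B} : ℝ≥0∞)

/-- `κ` is the law of the wired uniform spanning in-arboretum of `G` (as a random edge set,
encoded as an element of `E → Bool`): its cylinder probabilities are the limits along any
exhaustion of the uniform spanning in-arborescence measures of the wired graphs. -/
def IsWUALaw {V E : Type} (G : DigraphStruct V E) (κ : Measure (E → Bool)) : Prop :=
  κ Set.univ = 1 ∧
    ∀ Vn : ℕ → Set V, IsExhaustion Vn → ∀ F : Finset E,
      Filter.Tendsto (fun n => wiredUACyl G (Vn n) F) Filter.atTop
        (nhds (κ {A | ∀ e ∈ F, A e = true}))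

/-- A spanning in-arboretum rooted at infinity all of whose components are one-ended:
every vertex has out-degree exactly one, and the past of every vertex is finite. -/
def IsOneEndedSpanningArb {V E : Type} (G : DigraphStruct V E) (A : Set E) : Prop :=
  (∀ v : V, ∃! e : E, e ∈ A ∧ G.src e = v) ∧
    ∀ v : V, {u : V | Relation.ReflTransGen (G.step A) u v}.Finite

/-! ### Proper Gibbs measures on Eulerian paths -/

/-- `w` is a finite path in `G` starting at `o` (encoded by its edges). -/
def PrefixPath {V E : Type} (G : DigraphStruct V E) (o : V) {n : ℕ} (w : Fin n → E) : Prop :=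
  (∀ h : 0 < n, G.src (w ⟨0, h⟩) = o) ∧
    ∀ (i : ℕ) (h : i + 1 < n), G.dst (w ⟨i, Nat.lt_of_succ_lt h⟩) = G.src (w ⟨i + 1, h⟩)

/-- A proper Gibbs measure on Eulerian paths from `o` to `∞` in `G`: a probability measure on
edge sequences, supported on half-infinite paths started at `o` crossing every edge exactly once,
such that conditionally on the steps after time `n` the first `n` steps are a uniform Eulerian
path (from `o`, in the digraph spanned by the edges not crossed after time `n`, to the position
at time `n`). Uniformity is expressed by invariance under replacing the first `n` steps by any
other path from `o` crossing the same set of edges. -/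
def ProperGibbs {V E : Type} [MeasurableSpace E] (G : DigraphStruct V E) (o : V)
    (μ : Measure (ℕ → E)) : Prop :=
  μ Set.univ = 1 ∧
  μ {γ | (∀ i : ℕ, G.dst (γ i) = G.src (γ (i + 1))) ∧ G.src (γ 0) = o ∧ Function.Bijective γ}
      = 1 ∧
  ∀ (n : ℕ) (w w' : Fin n → E), Function.Injective w → Function.Injective w' →
    Set.range w = Set.range w' → PrefixPath G o w → PrefixPath G o w' →
    ∀ B : Set (ℕ → E),
      μ {γ | (∀ i : Fin n, γ (i : ℕ) = w i) ∧ (fun t : ℕ => γ (n + t)) ∈ B} =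
        μ {γ | (∀ i : Fin n, γ (i : ℕ) = w' i) ∧ (fun t : ℕ => γ (n + t)) ∈ B}

/-! ### Loop erasure and Wilson's algorithm rooted at infinity -/

/-- The loop-erasure times of the (transient) vertex sequence `p`:
`t₀ = 0`, `tᵢ₊₁ = 1 + max {t ≥ tᵢ : p t = p tᵢ}`. -/
noncomputable def leTimes {V : Type} (p : ℕ → V) : ℕ → ℕ
  | 0 => 0
  | i + 1 => sSup {t : ℕ | leTimes p i ≤ t ∧ p t = p (leTimes p i)} + 1

/-- The loop-erasure times of the vertex sequence `p` run up to time `k`. -/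
noncomputable def leTimesF {V : Type} (p : ℕ → V) (k : ℕ) : ℕ → ℕ
  | 0 => 0
  | i + 1 => sSup {t : ℕ | leTimesF p k i ≤ t ∧ t ≤ k ∧ p t = p (leTimesF p k i)} + 1

/-- The set of vertices incident to an edge of `A`. -/
def vertsOf {V E : Type} (G : DigraphStruct V E) (A : Set E) : Set V :=
  {u | ∃ e ∈ A, G.src e = u ∨ G.dst e = u}

open Classical in
/-- The set of edges of the loop-erasure of the walk `x` (an edge sequence) stopped when it
first hits `U`; if it never hits `U`, the loop-erasure of the whole (transient) walk. -/
noncomputable def stoppedLEedges {V E : Type} (G : DigraphStruct V E) (U : Set V) (x : ℕ → E) :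
    Set E :=
  if ∃ t : ℕ, G.src (x t) ∈ U then
    {e | ∃ i : ℕ,
      leTimesF (fun t => G.src (x t)) (sInf {t : ℕ | G.src (x t) ∈ U}) i <
          sInf {t : ℕ | G.src (x t) ∈ U} ∧
        x (leTimesF (fun t => G.src (x t)) (sInf {t : ℕ | G.src (x t) ∈ U}) i) = e}
  else Set.range fun i => x (leTimes (fun t => G.src (x t)) i)

/-- The partial edge sets generated by Wilson's algorithm rooted at infinity, run with the
enumeration `v` of the vertices and with `W j` the random walk used at stage `j + 1`
(started at `v j`). -/
noncomputable def wilsonA {V E : Type} (G : DigraphStruct V E) (v : ℕ → V) (W : ℕ → ℕ → E) :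
    ℕ → Set E
  | 0 => ∅
  | j + 1 =>
      wilsonA G v W j ∪
        stoppedLEedges G (vertsOf G (wilsonA G v W j) ∪ {u | ∃ i < j, v i = u}) (W j)

open Classical in
/-- Cylinder probabilities for the random walk on `G` started at `v`, recorded as a sequence of
edges: the probability that the first `n` crossed edges are `x 0, …, x (n-1)`. -/
noncomputable def edgeWalkCyl {V E : Type} (G : DigraphStruct V E) (v : V) (x : ℕ → E) (n : ℕ) :
    ℝ≥0∞ :=
  if (0 < n → G.src (x 0) = v) ∧ (∀ i : ℕ, i + 1 < n → G.dst (x i) = G.src (x (i + 1))) then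
    ∏ i ∈ Finset.range n, ((G.outDeg (G.src (x i)) : ℝ≥0∞))⁻¹
  else 0

/-- `P` is the joint law of a sequence of independent random walks on `G`, the `j`-th walk
started at `v j`. -/
def IsIndepWalksLaw {V E : Type} [MeasurableSpace E] (G : DigraphStruct V E) (v : ℕ → V)
    (P : Measure (ℕ → ℕ → E)) : Prop :=
  P Set.univ = 1 ∧
    ∀ (m n : ℕ) (x : ℕ → ℕ → E),
      P {ω | ∀ j < m, ∀ t < n, ω j t = x j t} =
        ∏ j ∈ Finset.range m, edgeWalkCyl G (v j) (x j) n

/-- `μ` is the law of the random walk on `G` started at `o`, recorded as its sequence of crossed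
edges. -/
def IsEdgeWalkLaw {V E : Type} [MeasurableSpace E] (G : DigraphStruct V E) (o : V)
    (μ : Measure (ℕ → E)) : Prop :=
  μ Set.univ = 1 ∧ ∀ (n : ℕ) (x : ℕ → E), μ {ω | ∀ i < n, ω i = x i} = edgeWalkCyl G o x n

/-! ### Finite approximations and Gibbs measures on arboreta -/

/-- A finite digraph with vertices and edges labelled by natural numbers. -/
structure FinDigraph where
  VS : Finset ℕ
  ES : Finset ℕ
  fsrc : ℕ → ℕ
  fdst : ℕ → ℕ

/-- `B` is a spanning in-arborescence of the finite digraph `H` rooted at `z`. -/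
def FinDigraph.IsArb (H : FinDigraph) (z : ℕ) (B : Finset ℕ) : Prop :=
  B ⊆ H.ES ∧ (∀ e ∈ B, H.fsrc e ≠ z) ∧
  (∀ v ∈ H.VS, v ≠ z → ∃! e : ℕ, e ∈ B ∧ H.fsrc e = v) ∧
  (∀ v ∈ H.VS, Relation.ReflTransGen
      (fun a b => ∃ e ∈ B, H.fsrc e = a ∧ H.fdst e = b) v z)

/-- A finite digraph `H` with a distinguished vertex `z`, together with a partial isomorphism
to a digraph on `(V, E)`: vertex and edge domains `A`, `F` in `H` and maps `φV`, `φE` to `V`, `E`. -/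
structure PIso (V E : Type) where
  H : FinDigraph
  z : ℕ
  A : Finset ℕ
  F : Finset ℕ
  φV : ℕ → V
  φE : ℕ → E

/-- The data of `p` really is a partial isomorphism to `G`. -/
def PIso.Valid {V E : Type} (p : PIso V E) (G : DigraphStruct V E) : Prop :=
  ↑p.A ⊆ ↑p.H.VS ∧ ↑p.F ⊆ ↑p.H.ES ∧ p.z ∈ p.H.VS ∧
  Set.InjOn p.φV ↑p.A ∧ Set.InjOn p.φE ↑p.F ∧
  ∀ e ∈ p.F, p.H.fsrc e ∈ p.A ∧ p.H.fdst e ∈ p.A ∧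
    G.src (p.φE e) = p.φV (p.H.fsrc e) ∧ G.dst (p.φE e) = p.φV (p.H.fdst e)

/-- The partial isomorphism `p` identifies a neighbourhood of (a preimage of) `w`:
`w` is in the range of `φV` and `φE` maps the edges incident to its preimage bijectively onto
the edges incident to `w`. -/
def PIso.GoodAt {V E : Type} (p : PIso V E) (G : DigraphStruct V E) (w : V) : Prop :=
  ∃ w' ∈ p.A, p.φV w' = w ∧
    (∀ e' ∈ p.H.ES, (p.H.fsrc e' = w' ∨ p.H.fdst e' = w') → e' ∈ p.F) ∧
    ∀ e : E, (G.src e = w ∨ G.dst e = w) →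
      ∃! e' : ℕ, e' ∈ p.F ∧ (p.H.fsrc e' = w' ∨ p.H.fdst e' = w') ∧ p.φE e' = e

/-- `a` is a finite approximation to `G`: a sequence of finite digraphs with distinguished
vertices `zₙ` and partial isomorphisms to `G`, identifying larger and larger neighbourhoods of
every finite vertex set, with the distinguished vertices escaping to infinity. -/
def IsFinApproxSeq {V E : Type} (G : DigraphStruct V E) (a : ℕ → PIso V E) : Prop :=
  (∀ n, (a n).Valid G) ∧
  (∀ W : Finset V, ∃ N, ∀ n ≥ N, ∀ w ∈ W, (a n).GoodAt G w) ∧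
  (∀ W : Finset V, ∃ N, ∀ n ≥ N, ¬((a n).z ∈ (a n).A ∧ (a n).φV (a n).z ∈ (W : Set V)))

/-- The probability, under the uniform spanning in-arborescence of `p.H` rooted at `p.z`, that
every edge of `F` is in the image of the arborescence under the partial isomorphism. -/
noncomputable def pisoUACyl {V E : Type} (p : PIso V E) (F : Finset E) :
    ℝ≥0∞ :=
  (Nat.card {B : Finset ℕ // p.H.IsArb p.z B ∧ ∀ e ∈ F, ∃ e' ∈ B, e' ∈ p.F ∧ p.φE e' = e} :
      ℝ≥0∞) /
    (Nat.card {B : Finset ℕ // p.H.IsArb p.z B} : ℝ≥0∞)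

/-- `μ` (a measure on edge sets, encoded as elements of `E → Bool`) is a Gibbs measure on
spanning in-arboreta of `G` rooted at infinity: it is a weak limit of mixtures (over a random
finite approximation to `G`) of uniform spanning in-arborescence measures on finite
approximations to `G`. -/
def IsArbGibbs {V E : Type} (G : DigraphStruct V E) (μ : Measure (E → Bool)) : Prop :=
  μ Set.univ = 1 ∧
  ∃ (Ω : Type) (mΩ : MeasurableSpace Ω) (ν : @Measure Ω mΩ) (a : Ω → ℕ → PIso V E),
    ν Set.univ = 1 ∧ (∀ ω : Ω, IsFinApproxSeq G (a ω)) ∧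
    ∀ F : Finset E,
      Filter.Tendsto (fun n => ∫⁻ ω, pisoUACyl (a ω n) F ∂ν) Filter.atTop
        (nhds (μ {A : E → Bool | ∀ e ∈ F, A e = true}))

/-! ### Stacks -/

open Classical in
/-- The state (current vertex, remaining stacks) after `n` steps of following the stacks `σ`
starting from `o`: at each step we cross the edge at the front of the list at the current vertex
and delete it from the list (doing nothing if the list is empty). -/
noncomputable def stackState {V E : Type} (G : DigraphStruct V E) (o : V) (σ : V → List E) :
    ℕ → V × (V → List E)
  | 0 => (o, σ)
  | n + 1 =>
    let p := stackState G o σ n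
    match p.2 p.1 with
    | [] => p
    | e :: rest => (G.dst e, Function.update p.2 p.1 rest)

/-- The edge crossed at step `n` when following the stacks `σ` from `o` (`none` if the
current stack is exhausted). -/
noncomputable def stackEdge {V E : Type} (G : DigraphStruct V E) (o : V) (σ : V → List E)
    (n : ℕ) : Option E :=
  ((stackState G o σ n).2 (stackState G o σ n).1).head?

/-- The sigma-algebra on stack configurations. -/
noncomputable def stackMS (V E : Type) : MeasurableSpace (V → List E) :=
  @MeasurableSpace.pi V (fun _ => List E) fun _ => ⊤

open Classical in
/-- `ρ` is the law of the random stack configuration built from a random arboretum with law `κ`: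
place the arboretum edge at the bottom of the stack at each vertex, and an independent,
uniformly random ordering of the remaining outgoing edges on top of it. -/
def IsStackLaw {V E : Type} (G : DigraphStruct V E) (κ : Measure (E → Bool))
    (ρ : @Measure (V → List E) (stackMS V E)) : Prop :=
  ρ Set.univ = 1 ∧
    ∀ (K : Finset V) (s : V → List E),
      ρ {σ | ∀ v ∈ K, σ v = s v} =
        if ∀ v ∈ K, (s v).Nodup ∧ ∀ e : E, e ∈ s v ↔ G.src e = v then
          κ {A | ∀ v ∈ K, ∃ e : E, (s v).getLast? = some e ∧ A e = true} *
            ∏ v ∈ K, (((G.outDeg v - 1).factorial : ℝ≥0∞))⁻¹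
        else 0

/-! ### Markov chains -/

open Classical in
/-- `ν` is the law of the trajectory of a Markov chain with state space `S' ⊆ S`, transition
kernel `p` and deterministic initial state `s0`. -/
def IsMCLaw {S : Type} [MeasurableSpace S] (S' : Set S) (p : S → S → ℝ≥0∞) (s0 : S)
    (ν : Measure (ℕ → S)) : Prop :=
  ν Set.univ = 1 ∧ s0 ∈ S' ∧
  (∀ u ∈ S', (∑' v : S, p u v) = 1 ∧ ∀ v : S, p u v ≠ 0 → v ∈ S') ∧
  (∀ u : S, u ∉ S' → ∀ v : S, p u v = 0) ∧
  ∀ (n : ℕ) (y : ℕ → S),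
    ν {x | ∀ i ≤ n, x i = y i} =
      if y 0 = s0 then ∏ i ∈ Finset.range n, p (y i) (y (i + 1)) else 0

/-- `ν` is the law of the trajectory of a recurrent Markov chain on a subset of `S` with
non-random initial state: the chain returns to its initial state infinitely often a.s. -/
def IsRecMCLaw {S : Type} [MeasurableSpace S] (ν : Measure (ℕ → S)) : Prop :=
  ∃ (S' : Set S) (p : S → S → ℝ≥0∞) (s0 : S),
    IsMCLaw S' p s0 ν ∧ ν {x | {i : ℕ | x i = s0}.Infinite} = 1

/-- `ν` is the law of the sequence of vertices visited by (the unique) proper Gibbs measure on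
Eulerian paths from `o` to `∞` on a sourced Eulerian digraph whose vertex set is a subset
of `S`. -/
def IsGibbsVertexLaw {S : Type} [MeasurableSpace S] (ν : Measure (ℕ → S)) : Prop :=
  ∃ (Vs : Set S) (E : Type) (mE : MeasurableSpace E) (G : DigraphStruct (↥Vs) E) (o : ↥Vs),
    Countable E ∧ G.IsSourcedEulerian o ∧
    ∃ μp : @Measure (ℕ → E) (@MeasurableSpace.pi ℕ (fun _ => E) fun _ => mE),
      @ProperGibbs (↥Vs) E mE G o μp ∧
      ∀ A : Set (ℕ → S), MeasurableSet A →
        ν A = μp ((fun (γ : ℕ → E) (i : ℕ) => ((G.src (γ i) : S))) ⁻¹' A)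

/-- Concatenation of a finite list with an infinite sequence. -/
def concatSeq {S : Type} (l : List S) (y : ℕ → S) : ℕ → S :=
  fun i => if h : i < l.length then l.get ⟨i, h⟩ else y (i - l.length)

/-- `ν` is the law of a process following a uniform random Eulerian path on a finite Eulerian
digraph with source and sink whose vertex set is a subset of `S`, followed by the trajectory of
an (independent) recurrent Markov chain on a disjoint subset of `S` with non-random initial
state. -/
def IsMixedLaw {S : Type} [MeasurableSpace S] (ν : Measure (ℕ → S)) : Prop :=
  ∃ (Vf : Finset S) (Ef : Type) (_ : Finite Ef)
    (Gf : DigraphStruct {s : S // s ∈ Vf} Ef) (of zf : {s : S // s ∈ Vf})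
    (Vr : Set S) (p : S → S → ℝ≥0∞) (s1 : S) (νMC : Measure (ℕ → S)),
    IsFinEulerian Gf of zf ∧ Disjoint (↑Vf : Set S) Vr ∧
    IsMCLaw Vr p s1 νMC ∧ νMC {x | {i : ℕ | x i = s1}.Infinite} = 1 ∧
    ∀ A : Set (ℕ → S), MeasurableSet A →
      ν A =
        (∑' L : {L : List Ef // IsEulerList Gf of zf L},
            νMC ((fun y => concatSeq (((of : S)) ::
              (L : List Ef).map fun e => ((Gf.dst e : S))) y) ⁻¹' A)) /
          (Nat.card {L : List Ef // IsEulerList Gf of zf L} : ℝ≥0∞)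

section Helpers

variable {V E : Type}

open Classical in
/-- Powers of a nonnegative kernel. -/
noncomputable def kpow (Q : V → V → ℝ≥0∞) : ℕ → V → V → ℝ≥0∞
  | 0 => fun u v => if u = v then 1 else 0
  | n + 1 => fun u v => ∑' w, Q u w * kpow Q n w v

/-- Green function of a nonnegative kernel. -/
noncomputable def kgreen (Q : V → V → ℝ≥0∞) (u v : V) : ℝ≥0∞ := ∑' n, kpow Q n u v

lemma kpow_succ_right (Q : V → V → ℝ≥0∞) (n : ℕ) (u v : V) :
    kpow Q (n + 1) u v = ∑' w, kpow Q n u w * Q w v := by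
  classical
  induction n generalizing u with
  | zero =>
    simp only [kpow]
    rw [tsum_eq_single v, tsum_eq_single u]
    · simp
    · intro b hb; simp [hb.symm]
    · intro b hb; simp [hb]
  | succ n ih =>
    rw [kpow]
    simp_rw [ih]
    simp_rw [kpow, ← ENNReal.tsum_mul_left, ← ENNReal.tsum_mul_right]
    rw [ENNReal.tsum_comm]
    simp_rw [mul_assoc]

lemma kpow_transpose (Q : V → V → ℝ≥0∞) (n : ℕ) (u v : V) :
    kpow (fun a b => Q b a) n u v = kpow Q n v u := by
  classical
  induction n generalizing u with
  | zero => simp [kpow, eq_comm]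
  | succ n ih =>
    rw [kpow_succ_right Q, kpow]
    simp_rw [ih]
    simp_rw [mul_comm]

open Classical in
lemma kgreen_le (Q : V → V → ℝ≥0∞) (f : V → ℝ≥0∞) (c : ℝ≥0∞) (w : V)
    (h : ∀ u, (∑' y, Q u y * f y) + (if u = w then c else 0) ≤ f u) (u : V) :
    c * kgreen Q u w ≤ f u := by
  have key : ∀ n u, c * ∑ k ∈ Finset.range n, kpow Q k u w ≤ f u := by
    intro n
    induction n with
    | zero => intro u; simp
    | succ n ih =>
      intro u
      refine le_trans ?_ (h u)
      rw [Finset.sum_range_succ', mul_add]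
      gcongr
      · simp_rw [kpow]
        rw [← Summable.tsum_finsetSum (fun _ _ => ENNReal.summable), ← ENNReal.tsum_mul_left]
        refine ENNReal.tsum_le_tsum fun y => ?_
        rw [← Finset.mul_sum, mul_left_comm]
        gcongr
        exact ih y
      · simp [kpow]
  rw [kgreen, ENNReal.tsum_eq_iSup_nat, ENNReal.mul_iSup]
  exact iSup_le fun n => key n u

lemma kgreen_pred (Q : V → V → ℝ≥0∞) {u w v : V} (hQ : Q u w ≠ 0) (h : kgreen Q w v = ⊤) :
    kgreen Q u v = ⊤ := by
  have : Q u w * kgreen Q w v ≤ kgreen Q u v := by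
    rw [kgreen, ← ENNReal.tsum_mul_left]
    calc ∑' i, Q u w * kpow Q i w v ≤ ∑' i, kpow Q (i + 1) u v :=
          ENNReal.tsum_le_tsum fun i => ENNReal.le_tsum (f := fun w => Q u w * kpow Q i w v) w
      _ ≤ _ := ENNReal.tsum_comp_le_tsum_of_injective (add_left_injective 1)
          (fun i => kpow Q i u v)
  rw [h, ENNReal.mul_top hQ] at this
  exact top_le_iff.1 this

lemma kgreen_transpose (Q : V → V → ℝ≥0∞) (u v : V) :
    kgreen (fun a b => Q b a) u v = kgreen Q v u := by
  simp_rw [kgreen, kpow_transpose]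

lemma kgreen_succ (Q : V → V → ℝ≥0∞) {u w v : V} (hQ : Q w u ≠ 0) (h : kgreen Q v w = ⊤) :
    kgreen Q v u = ⊤ := by
  rw [← kgreen_transpose] at h ⊢
  exact kgreen_pred (fun a b => Q b a) hQ h

lemma kgreen_max (Q : V → V → ℝ≥0∞) (hQ : ∀ u, ∑' w, Q u w ≤ 1) (u v : V) :
    kgreen Q u v ≤ kgreen Q v v := by
  have key : ∀ n u, ∑ k ∈ Finset.range n, kpow Q k u v ≤ kgreen Q v v := by
    intro n
    induction n with
    | zero => intro u; simp
    | succ n ih =>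
      intro u
      by_cases huv : u = v
      · subst huv
        exact ENNReal.sum_le_tsum _
      · rw [Finset.sum_range_succ']
        simp only [kpow, huv, if_false, add_zero]
        rw [← Summable.tsum_finsetSum (fun _ _ => ENNReal.summable)]
        calc _ ≤ ∑' y, Q u y * kgreen Q v v := by
              refine ENNReal.tsum_le_tsum fun y => ?_
              rw [← Finset.mul_sum]
              gcongr
              exact ih y
          _ ≤ 1 * kgreen Q v v := by
              rw [ENNReal.tsum_mul_right]
              gcongr
              exact hQ u
          _ = _ := one_mul _
  rw [kgreen, ENNReal.tsum_eq_iSup_nat]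
  exact iSup_le fun n => key n u

open Classical in
lemma tsum_count_src (F : Finset E) (s : E → V) (f : V → ℝ≥0∞) :
    ∑' y, (({e : E | e ∈ F ∧ s e = y}.ncard : ℕ) : ℝ≥0∞) * f y = ∑ e ∈ F, f (s e) := by
  have h1 : ∀ y, (({e : E | e ∈ F ∧ s e = y}.ncard : ℕ) : ℝ≥0∞)
      = ∑ e ∈ F, if s e = y then 1 else 0 := by
    intro y
    have : {e : E | e ∈ F ∧ s e = y} = ((F.filter fun e => s e = y : Finset E) : Set E) := by
      ext; simp
    rw [this, Set.ncard_coe_finset, Finset.sum_boole]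
  simp_rw [h1, Finset.sum_mul]
  rw [Summable.tsum_finsetSum (fun _ _ => ENNReal.summable)]
  refine Finset.sum_congr rfl fun e _ => ?_
  rw [tsum_eq_single (s e)]
  · simp
  · intro b hb; simp [hb.symm]

variable (G : DigraphStruct V E)

lemma stepProb_sum_le (hlf : G.LocallyFinite) (u : V) : ∑' w, G.stepProb u w ≤ 1 := by
  classical
  have h := tsum_count_src (hlf u).1.toFinset G.dst (fun _ => 1)
  simp only [Set.Finite.mem_toFinset, mul_one, Finset.sum_const, nsmul_eq_mul] at h
  have h2 : ((hlf u).1.toFinset.card) = G.outDeg u := by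
    rw [DigraphStruct.outDeg, Set.ncard_eq_toFinset_card _ (hlf u).1]
  rw [h2] at h
  simp only [DigraphStruct.outEdges, Set.mem_ofPred_eq] at h
  simp_rw [DigraphStruct.stepProb, div_eq_mul_inv]
  rw [ENNReal.tsum_mul_right, h, ← div_eq_mul_inv]
  exact ENNReal.div_self_le_one

lemma stepProb_ne_zero (hlf : G.LocallyFinite) (e : E) :
    G.stepProb (G.src e) (G.dst e) ≠ 0 := by
  rw [DigraphStruct.stepProb, Ne, ENNReal.div_eq_zero_iff, not_or]
  refine ⟨?_, ENNReal.natCast_ne_top _⟩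
  have hf : {e' : E | G.src e' = G.src e ∧ G.dst e' = G.dst e}.Finite :=
    (hlf (G.src e)).1.subset fun e' h => h.1
  have := (Set.ncard_pos hf).2 ⟨e, rfl, rfl⟩
  exact_mod_cast this.ne'

lemma exists_edge_of_stepProb {u w : V} (h : G.stepProb u w ≠ 0) :
    ∃ e, G.src e = u ∧ G.dst e = w := by
  by_contra hc
  apply h
  have : {e : E | G.src e = u ∧ G.dst e = w} = ∅ := by
    ext e; simp only [Set.mem_ofPred_eq, Set.mem_empty_iff_false, iff_false]
    exact fun he => hc ⟨e, he⟩
  simp [DigraphStruct.stepProb, this]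

open Classical in
lemma inflow_le (hlf : G.LocallyFinite) (K : Set V) (x : V) :
    ∑' y, G.stepProb y x * (if y ∈ K then (G.outDeg y : ℝ≥0∞) else 0) ≤
      (((hlf x).2.toFinset.filter fun e => G.src e ∈ K).card : ℝ≥0∞) := by
  have h := tsum_count_src (hlf x).2.toFinset G.src (fun y => if y ∈ K then 1 else 0)
  rw [Finset.sum_boole] at h
  rw [← h]
  refine ENNReal.tsum_le_tsum fun y => ?_
  split_ifs with hy
  · rw [DigraphStruct.stepProb, mul_one, mul_comm]
    refine ENNReal.mul_div_le.trans (le_of_eq ?_)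
    congr 3
    ext e
    simp [DigraphStruct.inEdges, and_comm]
  · simp

lemma card_inEdges (hlf : G.LocallyFinite) (x : V) :
    (hlf x).2.toFinset.card = G.inDeg x := by
  rw [DigraphStruct.inDeg, Set.ncard_eq_toFinset_card _ (hlf x).2]

/-- If `K` is closed under successors and at `w ∈ K` the inflow from `K` is strictly less than
the out-degree, then the Green function from `w` is finite. -/
lemma green_lt_top_of_deficit (hlf : G.LocallyFinite) (hge : ∀ v : V, G.inDeg v ≤ G.outDeg v)
    (K : Set V) (hK : ∀ e, G.src e ∈ K → G.dst e ∈ K) (w : V) (hw : w ∈ K)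
    (hdef : G.inDeg w < G.outDeg w ∨ ∃ e, G.dst e = w ∧ G.src e ∉ K) (v : V) :
    kgreen G.stepProb w v ≠ ⊤ := by
  classical
  have := kgreen_le (fun a b => G.stepProb b a)
    (fun y => if y ∈ K then (G.outDeg y : ℝ≥0∞) else 0) 1 w ?_ v
  · rw [kgreen_transpose, one_mul] at this
    refine ne_top_of_le_ne_top ?_ this
    split_ifs <;> simp
  · intro x
    refine (add_le_add_left (inflow_le G hlf K x) _).trans ?_
    by_cases hx : x ∈ K
    · have hle : ((hlf x).2.toFinset.filter fun e => G.src e ∈ K).card ≤ G.inDeg x := by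
        rw [← card_inEdges G hlf]; exact Finset.card_filter_le _ _
      simp only [hx, if_true]
      have h3 := hge x
      split_ifs with hxw
      · subst hxw
        have : ((hlf x).2.toFinset.filter fun e => G.src e ∈ K).card + 1 ≤ G.outDeg x := by
          rcases hdef with h | ⟨e, he, he'⟩
          · omega
          · have : ((hlf x).2.toFinset.filter fun e => G.src e ∈ K).card < G.inDeg x := by
              rw [← card_inEdges G hlf]
              apply Finset.card_lt_card
              rw [Finset.filter_ssubset]
              exact ⟨e, by simpa [DigraphStruct.inEdges] using he, he'⟩
            omega
        exact_mod_cast this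
      · rw [add_zero]
        exact_mod_cast hle.trans h3
    · have hxw : x ≠ w := fun h => hx (h ▸ hw)
      have : ((hlf x).2.toFinset.filter fun e => G.src e ∈ K) = ∅ := by
        rw [Finset.filter_eq_empty_iff]
        intro e he hs
        have h4 : G.dst e = x := by simpa [DigraphStruct.inEdges] using he
        exact hx (h4 ▸ hK e hs)
      simp [this, hxw, hx]

lemma green_diag_ne_top (hconn : G.Connected) (hlf : G.LocallyFinite)
    (hge : ∀ v : V, G.inDeg v ≤ G.outDeg v) (v0 : V) (hv0 : G.inDeg v0 < G.outDeg v0) (v : V) :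
    kgreen G.stepProb v v ≠ ⊤ := by
  classical
  intro hv
  set P := G.stepProb with hP
  set K : Set V := {w | kgreen P w v = ⊤ ∧ kgreen P v w = ⊤} with hKdef
  have hsucc : ∀ e, G.src e ∈ K → G.dst e ∈ K := by
    intro e he
    refine ⟨?_, kgreen_succ P (stepProb_ne_zero G hlf e) he.2⟩
    by_contra hA
    have := kgreen_le P (fun y => if kgreen P y v = ⊤ then 1 else 0)
      (P (G.src e) (G.dst e)) (G.src e) ?_ v
    · rw [he.2, ENNReal.mul_top (stepProb_ne_zero G hlf e)] at this
      simp [hv] at this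
    · intro u
      by_cases hu : kgreen P u v = ⊤
      · simp only [hu, if_true]
        split_ifs with hue
        · subst hue
          refine le_trans ?_ (stepProb_sum_le G hlf (G.src e))
          have h1 : P (G.src e) (G.dst e)
              = ∑' y, if y = G.dst e then P (G.src e) y else 0 := by
            rw [tsum_ite_eq]
          rw [h1, ← ENNReal.tsum_add]
          refine ENNReal.tsum_le_tsum fun y => ?_
          by_cases hy : y = G.dst e
          · subst hy; simp only [hA, if_false, mul_zero, zero_add, if_true]; exact le_rfl
          · simp only [hy, if_false, add_zero]
            split_ifs <;> simp [hP]
        · rw [add_zero]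
          refine le_trans ?_ (stepProb_sum_le G hlf u)
          refine ENNReal.tsum_le_tsum fun y => ?_
          split_ifs <;> simp [hP]
      · have hue : u ≠ G.src e := fun h => hu (h ▸ he.1)
        simp only [hu, hue, if_false, add_zero]
        refine le_of_eq (ENNReal.tsum_eq_zero.2 fun y => ?_)
        split_ifs with hy
        · rw [mul_one]
          by_contra hne
          exact hu (kgreen_pred P hne hy)
        · simp
  have hpred : ∀ e, G.dst e ∈ K → G.src e ∈ K := by
    intro e he
    by_contra hs
    exact green_lt_top_of_deficit G hlf hge K hsucc _ he (Or.inr ⟨e, rfl, hs⟩) v he.1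
  have hall : ∀ w, w ∈ K := by
    intro w
    induction hconn v w with
    | refl => exact ⟨hv, hv⟩
    | tail _ h ih =>
      obtain ⟨e, ⟨h1, h2⟩ | ⟨h1, h2⟩⟩ := h
      · rw [← h2]; apply hsucc; rw [h1]; exact ih
      · rw [← h1]; apply hpred; rw [h2]; exact ih
  exact green_lt_top_of_deficit G hlf hge K hsucc v0 (hall v0) (Or.inl hv0) v (hall v0).1

lemma walk_cyl_le [Countable V] [MeasurableSpace V] (o : V) (μ : Measure (ℕ → V))
    (hμ : G.IsWalkLaw o μ) (v : V) (k : ℕ) : ∀ (n : ℕ) (x : ℕ → V),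
    μ {ω | (∀ i ≤ n, ω i = x i) ∧ ω (n + k) = v} ≤
      μ {ω | ∀ i ≤ n, ω i = x i} * kpow G.stepProb k (x n) v := by
  classical
  induction k with
  | zero =>
    intro n x
    by_cases h : x n = v
    · simp only [kpow, h, if_true, mul_one]
      exact measure_mono fun ω h => h.1
    · have : {ω : ℕ → V | (∀ i ≤ n, ω i = x i) ∧ ω (n + 0) = v} = ∅ := by
        ext ω
        simp only [Set.mem_ofPred_eq, Set.mem_empty_iff_false, iff_false]
        rintro ⟨h1, h2⟩
        exact h ((h1 n le_rfl).symm.trans h2)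
      rw [this]; simp
  | succ k ih =>
    intro n x
    have hsub : {ω : ℕ → V | (∀ i ≤ n, ω i = x i) ∧ ω (n + (k + 1)) = v} ⊆
        ⋃ w, {ω : ℕ → V | (∀ i ≤ n + 1, ω i = Function.update x (n + 1) w i) ∧
          ω (n + 1 + k) = v} := by
      rintro ω ⟨h1, h2⟩
      refine Set.mem_iUnion.2 ⟨ω (n + 1), ?_, ?_⟩
      · intro i hi
        rcases Nat.lt_or_eq_of_le hi with h | h
        · rw [Function.update_of_ne (by omega)]
          exact h1 i (by omega)
        · subst h; simp
      · rw [← h2]; congr 1; omega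
    refine (measure_mono hsub).trans ((measure_iUnion_le _).trans ?_)
    rw [kpow, ← ENNReal.tsum_mul_left]
    refine ENNReal.tsum_le_tsum fun w => (ih (n + 1) _).trans (le_of_eq ?_)
    rw [hμ.2, hμ.2, Function.update_self, ← mul_assoc]
    congr 1
    rw [Function.update_of_ne (by omega : 0 ≠ n + 1)]
    split_ifs
    · rw [Finset.prod_range_succ, Function.update_self, Function.update_of_ne (by omega)]
      congr 1
      refine Finset.prod_congr rfl fun i hi => ?_
      have := Finset.mem_range.1 hi
      rw [Function.update_of_ne (by omega), Function.update_of_ne (by omega)]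
    · simp

lemma walk_marginal_le [Countable V] [MeasurableSpace V] (o : V) (μ : Measure (ℕ → V))
    (hμ : G.IsWalkLaw o μ) (v : V) (k : ℕ) :
    μ {ω | ω k = v} ≤ kpow G.stepProb k o v := by
  classical
  have hsub : {ω : ℕ → V | ω k = v} ⊆
      ⋃ w, {ω : ℕ → V | (∀ i ≤ 0, ω i = (fun _ => w : ℕ → V) i) ∧ ω (0 + k) = v} := by
    intro ω h
    refine Set.mem_iUnion.2 ⟨ω 0, ?_, ?_⟩
    · intro i hi
      have : i = 0 := by omega
      subst this; rfl
    · rw [zero_add]; exact h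
  refine (measure_mono hsub).trans ((measure_iUnion_le _).trans ?_)
  calc _ ≤ ∑' w, (if w = o then 1 else 0) * kpow G.stepProb k w v := by
        refine ENNReal.tsum_le_tsum fun w => (walk_cyl_le G o μ hμ v k 0 _).trans (le_of_eq ?_)
        rw [hμ.2]
        simp
    _ = kpow G.stepProb k o v := by
        rw [tsum_eq_single o]
        · simp
        · intro b hb; simp [hb]

end Helpers

/-- A connected, locally finite digraph in which every vertex has out-degree
at least its in-degree, with strict inequality somewhere, is transient. -/
theorem stmt11 {V E : Type} [Countable V] [Countable E] [MeasurableSpace V]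
    [DiscreteMeasurableSpace V]
    (G : DigraphStruct V E) (hconn : G.Connected) (hlf : G.LocallyFinite)
    (hge : ∀ v : V, G.inDeg v ≤ G.outDeg v) (v0 : V) (hv0 : G.inDeg v0 < G.outDeg v0) :
    G.TransientDigraph := by
  intro o μ hμ
  have : ∀ᵐ ω ∂μ, ∀ v : V, {i : ℕ | ω i = v}.Finite := by
    rw [ae_all_iff]
    intro v
    have hfin : ∑' k, μ {ω | ω k = v} ≠ ⊤ := by
      refine ne_top_of_le_ne_top (green_diag_ne_top G hconn hlf hge v0 hv0 v) ?_
      refine le_trans ?_ (kgreen_max G.stepProb (stepProb_sum_le G hlf) o v)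
      exact ENNReal.tsum_le_tsum fun k => walk_marginal_le G o μ hμ v k
    exact ae_finite_setOfPred_mem hfin
  rw [← hμ.1]
  refine measure_congr ?_
  filter_upwards [this] with ω hω
  exact propext ⟨fun _ => trivial, fun _ => hω⟩

end DF
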